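/- (Energy-Lipschitz bound for Schur complements over non-resonant annuli.) Let d ≥ 1, h > 4d+1, 0 < β ≤ 1, ι = min{1/100, (h−4d−β)/2}. Let B ⊂ B̄ ⊂ ℤ^d be finite sets such that B̄ ∖ B is non-resonant (B̄∖B ⊂ {x : V_hi(x) = h}), and let Γ : ℓ²(B) → ℓ²(B̄∖B) be the coupling operator induced by −Δ, i.e. Γ(y,x) = −1 if x ∈ B, y ∈ B̄∖B, x ∼ y, and 0 otherwise. For ℰ ∈ [−ι, 4d+β+ι] define the Schur complement S_ℰ = H_B − Γᵀ (H_{B̄∖B} − ℰ)^{−1} Γ on ℓ²(B). Then for all ℰ, ℰ′ ∈ [−ι, 4d+β+ι]: ‖S_ℰ − S_{ℰ′}‖ ≤ (2d/(h−4d−β−ι))² · |ℰ − ℰ′|. In particular, if (2d/(h−2d−2))² ≤ (4d+h+1)^{−1.9}, then ‖S_ℰ − S_{ℰ′}‖ ≤ γ^{1.9} |ℰ − ℰ′| with γ = 1/(4d+h+β). -/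

import Mathlib

noncomputable section

open scoped ENNReal

namespace HierABM

/-- Sites of the lattice `ℤ^d`. -/
abbrev Site (d : ℕ) := Fin d → ℤ

variable {d : ℕ}

/-- The `ℓ∞`-norm of a lattice site (as a natural number). -/
def linf (x : Site d) : ℕ := Finset.univ.sup fun i => (x i).natAbs

/-- The `ℓ∞`-distance between two lattice sites (as a natural number). -/
def linfDist (x y : Site d) : ℕ := Finset.univ.sup fun i => (x i - y i).natAbs

/-- The `ℓ¹`-distance between two lattice sites; `x ∼ y` means `l1dist x y = 1`. -/
def l1dist (x y : Site d) : ℤ := ∑ i, |x i - y i|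

/-- The `i`-th standard basis vector of `ℤ^d`. -/
def unit (i : Fin d) : Site d := fun j => if j = i then 1 else 0

/-- The discrete Laplacian `Δf(x) = ∑_{y ∼ x} f(y)`. -/
def discLap (f : Site d → ℝ) (x : Site d) : ℝ :=
  ∑ i : Fin d, (f (x + unit i) + f (x - unit i))

/-- The pointwise action of `H(ω) = 2d - Δ + V_hi + β ω`. -/
def hamAct (Vhi : Site d → ℝ) (β : ℝ) (ω : Site d → Bool)
    (f : Site d → ℝ) (x : Site d) : ℝ :=
  (2 * d + Vhi x + β * (if ω x then 1 else 0)) * f x - discLap f x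

/-- The Newtonian scales `d_k = d₀^(α^k)`, i.e. `d_{k+1} = d_k^α`. -/
def nscale (d₀ α : ℝ) (k : ℕ) : ℝ := d₀ ^ (α ^ k)

/-- The block `Λ_k(j) = {x : |x - j|_∞ ≤ 2⌊3 d_k⌋}`. -/
def LambdaS (d₀ α : ℝ) (k : ℕ) (j : Site d) : Set (Site d) :=
  {x | (linfDist x j : ℤ) ≤ 2 * ⌊3 * nscale d₀ α k⌋}

/-- `diam A ≤ r` in the `ℓ∞`-metric. -/
def diamLE (A : Set (Site d)) (r : ℤ) : Prop :=
  ∀ a ∈ A, ∀ b ∈ A, (linfDist a b : ℤ) ≤ r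

/-- `dist(A, B) ≥ r` in the `ℓ∞`-metric. -/
def setDistGE (A B : Set (Site d)) (r : ℝ) : Prop :=
  ∀ a ∈ A, ∀ b ∈ B, r ≤ (linfDist a b : ℝ)

/-- The potential with zero set `W` is `(k, N)`-hierarchical in `Λ_k(j)`. -/
def IsHierIn (d₀ α : ℝ) (N : ℕ) (W : Set (Site d)) : ℕ → Site d → Prop
  | 0, _ => True
  | 1, j => ∃ (m : ℕ) (C : Fin (m + 1) → Set (Site d)),
      m + 1 ≤ N ∧
      W ∩ LambdaS d₀ α 1 j = ⋃ s, C s ∧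
      (∀ s, diamLE (C s) (4 * ⌊3 * d₀⌋)) ∧
      C 0 ⊆ LambdaS d₀ α 0 j ∧
      (∀ s t, s ≠ t → setDistGE (C s) (C t) (2 * nscale d₀ α 1))
  | (k + 2), j => ∃ (m : ℕ) (C : Fin (m + 1) → Set (Site d)),
      m + 1 ≤ N ∧
      W ∩ LambdaS d₀ α (k + 2) j = ⋃ s, C s ∧
      C 0 ⊆ LambdaS d₀ α (k + 1) j ∧
      (∀ s t, s ≠ t → setDistGE (C s) (C t) (2 * nscale d₀ α (k + 2))) ∧
      IsHierIn d₀ α N W (k + 1) j ∧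
      (∀ s : Fin (m + 1), s ≠ 0 → ∃ js : Site d,
        LambdaS d₀ α (k + 1) js ⊆ LambdaS d₀ α (k + 2) j ∧
        C s ⊆ LambdaS d₀ α (k + 1) js ∧
        IsHierIn d₀ α N W (k + 1) js)

/-- `V_hi` is a hierarchical potential with scales `d₀, α`, well density `N`
and barrier height `h`. -/
def IsHierPot (d₀ α : ℝ) (N : ℕ) (h : ℝ) (Vhi : Site d → ℝ) : Prop :=
  (∀ x, Vhi x = 0 ∨ Vhi x = h) ∧
  ∀ k : ℕ, 1 ≤ k → IsHierIn d₀ α N {x | Vhi x = 0} k 0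

/-- The parameter `ι = min{1/100, (h - 4d - β)/2}`. -/
def iota (d : ℕ) (h β : ℝ) : ℝ := min (1 / 100) ((h - 4 * d - β) / 2)

/-- `ℙ` is the i.i.d. Bernoulli(1/2) product measure on `{0,1}^{ℤ^d}`. -/
def IsBernoulliProduct (d : ℕ) (ℙ : MeasureTheory.Measure (Site d → Bool)) : Prop :=
  ∀ (S : Finset (Site d)) (v : Site d → Bool),
    ℙ {ω | ∀ x ∈ S, ω x = v x} = (1 / 2 : ℝ≥0∞) ^ S.card

/-- The lattice box of (integer) radius `R` about `c`, as a finset. -/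
def boxF {d : ℕ} (c : Site d) (R : ℤ) : Finset (Site d) :=
  Fintype.piFinset fun i => Finset.Icc (c i - R) (c i + R)

/-- The block `Λ_k(j)` as a finset. -/
def LambdaF {d : ℕ} (d₀ α : ℝ) (k : ℕ) (j : Site d) : Finset (Site d) :=
  boxF j (2 * ⌊3 * nscale d₀ α k⌋)

/-- `Λ̄_k(j)`, the `(d_{k+1}/10)`-neighborhood of `Λ_k(j)`, as a finset. -/
def barLambdaF {d : ℕ} (d₀ α : ℝ) (k : ℕ) (j : Site d) : Finset (Site d) :=
  boxF j (2 * ⌊3 * nscale d₀ α k⌋ + ⌊nscale d₀ α (k + 1) / 10⌋)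

/-- The Dirichlet restriction `H_Λ = R_Λ H(ω) R_Λ` of `H(ω) = 2d - Δ + V_hi + βω`,
as a matrix indexed by `Λ`: its entries are `2d + V_hi(x) + βω(x)` on the diagonal and
`-1` between nearest neighbors. -/
def HMat {d : ℕ} (Vhi : Site d → ℝ) (β : ℝ) (ω : Site d → Bool) (Λ : Finset (Site d)) :
    Matrix Λ Λ ℝ := fun x y =>
  (if x = y then 2 * d + Vhi (x : Site d) + β * (if ω (x : Site d) then 1 else 0) else 0)
  - (if l1dist (x : Site d) (y : Site d) = 1 then 1 else 0)
/-- The coupling matrix `Γ : ℓ²(B) → ℓ²(A)` induced by `-Δ`: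
`Γ(y, x) = -1` if `x ∼ y` and `0` otherwise. -/
def coupling {d : ℕ} (B A : Finset (Site d)) : Matrix A B ℝ := fun y x =>
  if l1dist (y : Site d) (x : Site d) = 1 then -1 else 0

/-- The Schur complement `S_ℰ = H_B - Γᵀ (H_{B̄∖B} - ℰ)⁻¹ Γ` of `H_{B̄}` with respect
to the block `B`, at energy `ℰ`. -/
def schurC {d : ℕ} (Vhi : Site d → ℝ) (β : ℝ) (ω : Site d → Bool)
    (B Bbar : Finset (Site d)) (ℰ : ℝ) : Matrix B B ℝ :=
  HMat Vhi β ω B -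
    (coupling B (Bbar \ B)).transpose *
      (HMat Vhi β ω (Bbar \ B) - ℰ • (1 : Matrix ↥(Bbar \ B) ↥(Bbar \ B) ℝ))⁻¹ *
      coupling B (Bbar \ B)

/-- The Euclidean (`ℓ²`) norm of a finitely supported vector. -/
def l2norm {ι : Type*} [Fintype ι] (v : ι → ℝ) : ℝ := Real.sqrt (∑ i, v i ^ 2)

lemma l1dist_comm (x y : Site d) : l1dist x y = l1dist y x :=
  Finset.sum_congr rfl fun i _ => abs_sub_comm (x i) (y i)

lemma exists_eq_add_or_sub_unit {x y : Site d} (hxy : l1dist x y = 1) :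
    ∃ i, x = y + unit i ∨ x = y - unit i := by
  have hne : ∃ i, x i ≠ y i := by
    by_contra! hcon
    simp [l1dist, hcon] at hxy
  obtain ⟨i, hi⟩ := hne
  have hpos : 1 ≤ |x i - y i| := Int.one_le_abs (sub_ne_zero.mpr hi)
  have hsplit := Finset.add_sum_erase Finset.univ (fun j => |x j - y j|) (Finset.mem_univ i)
  have hnonneg : 0 ≤ ∑ j ∈ Finset.univ.erase i, |x j - y j| :=
    Finset.sum_nonneg fun _ _ => abs_nonneg _
  unfold l1dist at hxy
  have hrest : ∑ j ∈ Finset.univ.erase i, |x j - y j| = 0 := by omega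
  have hone : |x i - y i| = 1 := by omega
  have hzero : ∀ j, j ≠ i → x j = y j := by
    intro j hj
    have := (Finset.sum_eq_zero_iff_of_nonneg fun _ _ => abs_nonneg _).mp hrest j
      (Finset.mem_erase.mpr ⟨hj, Finset.mem_univ j⟩)
    exact sub_eq_zero.mp (abs_eq_zero.mp this)
  refine ⟨i, ?_⟩
  rcases (abs_eq (by norm_num : (0 : ℤ) ≤ 1)).mp hone with h1 | h1
  · left
    funext j
    by_cases hj : j = i
    · subst hj; simp [unit]; omega
    · simp [unit, hj, hzero j hj]
  · right
    funext j
    by_cases hj : j = i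
    · subst hj; simp [unit]; omega
    · simp [unit, hj, hzero j hj]

/-- A lattice site has at most `2d` nearest neighbors. -/
lemma card_neighbors_le (S : Finset (Site d)) (y : Site d) :
    (S.filter fun x => l1dist x y = 1).card ≤ 2 * d := by
  classical
  have hsub : (S.filter fun x => l1dist x y = 1) ⊆
      (Finset.univ.image fun i : Fin d => y + unit i) ∪
        (Finset.univ.image fun i : Fin d => y - unit i) := by
    intro x hx
    obtain ⟨i, hi | hi⟩ := exists_eq_add_or_sub_unit (Finset.mem_filter.mp hx).2
    · exact Finset.mem_union_left _ (Finset.mem_image.mpr ⟨i, Finset.mem_univ i, hi.symm⟩)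
    · exact Finset.mem_union_right _ (Finset.mem_image.mpr ⟨i, Finset.mem_univ i, hi.symm⟩)
  calc _ ≤ _ := Finset.card_le_card hsub
    _ ≤ _ := Finset.card_union_le _ _
    _ ≤ d + d := by
      gcongr <;> exact Finset.card_image_le.trans (by simp)
    _ = 2 * d := by ring

lemma sum_neighbors_le (S : Finset (Site d)) (y : Site d) :
    ∑ x ∈ S, (if l1dist x y = 1 then (1 : ℝ) else 0) ≤ 2 * d := by
  rw [Finset.sum_boole]
  exact_mod_cast card_neighbors_le S y

/-- Summation over nearest neighbors has norm at most `2d` on `ℓ²`. -/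
lemma sum_sq_neighbor_sum_le (S A : Finset (Site d)) (u : A → ℝ) :
    ∑ x ∈ S, (∑ y : A, (if l1dist x (y : Site d) = 1 then (1 : ℝ) else 0) * u y) ^ 2 ≤
      (2 * d) ^ 2 * ∑ y, u y ^ 2 := by
  have hrow : ∀ x : Site d,
      (∑ y : A, (if l1dist x (y : Site d) = 1 then (1 : ℝ) else 0) * u y) ^ 2 ≤
        2 * d * ∑ y : A, (if l1dist x (y : Site d) = 1 then (1 : ℝ) else 0) * u y ^ 2 := by
    intro x
    have hcs := Finset.sum_sq_le_sum_mul_sum_of_sq_le_mul (Finset.univ : Finset A)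
      (r := fun y => (if l1dist x (y : Site d) = 1 then (1 : ℝ) else 0) * u y)
      (f := fun y => if l1dist x (y : Site d) = 1 then (1 : ℝ) else 0)
      (g := fun y => (if l1dist x (y : Site d) = 1 then (1 : ℝ) else 0) * u y ^ 2)
      (fun y _ => by split_ifs <;> norm_num) (fun y _ => by split_ifs <;> simp [sq_nonneg])
      (fun y _ => by split_ifs <;> simp)
    refine hcs.trans (mul_le_mul_of_nonneg_right ?_
      (Finset.sum_nonneg fun y _ => by split_ifs <;> simp [sq_nonneg]))
    have hdeg := sum_neighbors_le A x
    rw [← Finset.sum_coe_sort] at hdeg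
    simpa only [l1dist_comm x] using hdeg
  calc _ ≤ ∑ x ∈ S, 2 * d *
        ∑ y : A, (if l1dist x (y : Site d) = 1 then (1 : ℝ) else 0) * u y ^ 2 :=
        Finset.sum_le_sum fun x _ => hrow x
    _ = 2 * d * ∑ y : A,
        (∑ x ∈ S, (if l1dist x (y : Site d) = 1 then (1 : ℝ) else 0)) * u y ^ 2 := by
        rw [← Finset.mul_sum, Finset.sum_comm]
        simp only [Finset.sum_mul]
    _ ≤ 2 * d * ∑ y : A, (2 * d) * u y ^ 2 := by
        gcongr with y
        exact sum_neighbors_le S y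
    _ = _ := by rw [← Finset.mul_sum]; ring

section EuclideanNorm

variable {X : Type*} [Fintype X]

lemma l2norm_eq_norm (v : X → ℝ) : l2norm v = ‖WithLp.toLp 2 v‖ := by
  simp [l2norm, EuclideanSpace.norm_eq]

lemma l2norm_nonneg (v : X → ℝ) : 0 ≤ l2norm v := Real.sqrt_nonneg _

lemma l2norm_sq (v : X → ℝ) : l2norm v ^ 2 = ∑ i, v i ^ 2 :=
  Real.sq_sqrt (Finset.sum_nonneg fun _ _ => sq_nonneg _)

lemma dotProduct_self_eq_l2norm_sq (v : X → ℝ) : v ⬝ᵥ v = l2norm v ^ 2 := by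
  simp only [l2norm_sq, dotProduct, ← sq]

lemma l2norm_add_le (v w : X → ℝ) : l2norm (v + w) ≤ l2norm v + l2norm w := by
  simp only [l2norm_eq_norm, WithLp.toLp_add]
  exact norm_add_le _ _

lemma l2norm_smul (c : ℝ) (v : X → ℝ) : l2norm (c • v) = |c| * l2norm v := by
  simp only [l2norm_eq_norm, WithLp.toLp_smul, norm_smul, Real.norm_eq_abs]

lemma dotProduct_le_l2norm_mul (v w : X → ℝ) : v ⬝ᵥ w ≤ l2norm v * l2norm w :=
  Real.sum_mul_le_sqrt_mul_sqrt _ _ _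

lemma eq_zero_of_l2norm_le_zero {v : X → ℝ} (hv : l2norm v ≤ 0) : v = 0 := by
  rw [l2norm_eq_norm, norm_le_zero_iff] at hv
  simpa using hv

end EuclideanNorm

/-- If `‖Tu‖² + ‖Pu‖² ≤ m²‖u‖²` and `D ≥ δ > m` is diagonal, then
`‖Pu‖² ≤ m² / (δ² - m²) ‖(D - T)u‖²`, and `D - T` is bounded below by `δ - m`. -/
lemma bounds_of_diagonal_sub {X Y : Type*} [Fintype X] [Fintype Y]
    (f u t D : X → ℝ) (p : Y → ℝ) {m δ : ℝ} (hm : 0 ≤ m) (hδ : m < δ)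
    (hD : ∀ x, δ ≤ D x) (hf : ∀ x, f x = D x * u x - t x)
    (htp : l2norm t ^ 2 + l2norm p ^ 2 ≤ m ^ 2 * l2norm u ^ 2) :
    (δ - m) * l2norm u ≤ l2norm f ∧
      l2norm p ^ 2 ≤ m ^ 2 / (δ ^ 2 - m ^ 2) * l2norm f ^ 2 := by
  have hu := l2norm_nonneg u
  have ht := l2norm_nonneg t
  have hDu : δ * l2norm u ≤ l2norm f + l2norm t := by
    refine le_trans ?_ (l2norm_add_le f t)
    refine (abs_le_of_sq_le_sq' ?_ (l2norm_nonneg _)).2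
    rw [mul_pow, l2norm_sq, l2norm_sq, Finset.mul_sum]
    refine Finset.sum_le_sum fun x _ => ?_
    rw [Pi.add_apply, hf, sub_add_cancel, mul_pow]
    have := hD x
    gcongr
    linarith
  have htm : l2norm t ≤ m * l2norm u := by
    refine (abs_le_of_sq_le_sq' ?_ (by positivity)).2
    nlinarith [sq_nonneg (l2norm p)]
  refine ⟨by linarith, ?_⟩
  have hden : 0 < δ ^ 2 - m ^ 2 := by nlinarith
  have hlow : (δ * l2norm u - l2norm t) ^ 2 ≤ l2norm f ^ 2 := by
    have : 0 ≤ δ * l2norm u - l2norm t := by nlinarith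
    gcongr
    linarith
  rw [div_mul_eq_mul_div, le_div_iff₀ hden]
  have h1 : l2norm p ^ 2 * (δ ^ 2 - m ^ 2) ≤
      (m ^ 2 * l2norm u ^ 2 - l2norm t ^ 2) * (δ ^ 2 - m ^ 2) := by
    gcongr
    linarith
  have h2 : m ^ 2 * (δ * l2norm u - l2norm t) ^ 2 ≤ m ^ 2 * l2norm f ^ 2 := by
    gcongr
  nlinarith [sq_nonneg (δ * l2norm t - m ^ 2 * l2norm u)]

/-- Lower bounds for `H_A - ℰ` on a non-resonant set `A`, with the coupling to a disjoint
block `B` taken into account. -/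
lemma hamiltonian_sub_bounds {Vhi : Site d → ℝ} {β h ℰ δ : ℝ} {ω : Site d → Bool}
    {A B : Finset (Site d)} (hAB : Disjoint A B) (hβ : 0 ≤ β)
    (hres : ∀ x ∈ A, Vhi x = h) (hδ : 2 * (d : ℝ) < δ) (hℰ : ℰ ≤ 2 * d + h - δ) (u : A → ℝ) :
    (δ - 2 * d) * l2norm u ≤ l2norm ((HMat Vhi β ω A - ℰ • (1 : Matrix A A ℝ)).mulVec u) ∧
      l2norm ((coupling B A).transpose.mulVec u) ^ 2 ≤
        (2 * d) ^ 2 / (δ ^ 2 - (2 * d) ^ 2) *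
          l2norm ((HMat Vhi β ω A - ℰ • (1 : Matrix A A ℝ)).mulVec u) ^ 2 := by
  refine bounds_of_diagonal_sub _ u
    (fun x : A => ∑ y : A, (if l1dist (x : Site d) (y : Site d) = 1 then (1 : ℝ) else 0) * u y)
    (fun x : A => 2 * d + Vhi (x : Site d) + β * (if ω (x : Site d) then 1 else 0) - ℰ)
    _ (by positivity) hδ ?_ ?_ ?_
  · intro x
    have h1 := hres x x.2
    have h2 : 0 ≤ β * (if ω (x : Site d) then 1 else 0) := by split_ifs <;> simp [hβ]
    linarith
  · intro x
    simp only [Matrix.mulVec, dotProduct, HMat, Matrix.sub_apply, Matrix.smul_apply,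
      Matrix.one_apply, smul_eq_mul, sub_mul, Finset.sum_sub_distrib, ite_mul, mul_ite, mul_one,
      mul_zero, zero_mul, one_mul, Finset.sum_ite_eq, Finset.mem_univ, if_true]
    ring
  · have hall := sum_sq_neighbor_sum_le (A ∪ B) A u
    rw [Finset.sum_union hAB, ← Finset.sum_coe_sort A, ← Finset.sum_coe_sort B] at hall
    rw [l2norm_sq, l2norm_sq, l2norm_sq]
    refine le_of_eq_of_le (congrArg₂ (· + ·) rfl (Finset.sum_congr rfl fun x _ => ?_)) hall
    rw [← neg_sq]
    congr 1
    simp only [Matrix.mulVec, dotProduct, Matrix.transpose_apply, coupling,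
      ← Finset.sum_neg_distrib]
    refine Finset.sum_congr rfl fun y _ => ?_
    rw [l1dist_comm (x : Site d)]
    split_ifs <;> simp

lemma HMat_sub_smul_one_transpose (Vhi : Site d → ℝ) (β ℰ : ℝ) (ω : Site d → Bool)
    (A : Finset (Site d)) :
    (HMat Vhi β ω A - ℰ • (1 : Matrix A A ℝ)).transpose = HMat Vhi β ω A - ℰ • 1 := by
  rw [Matrix.transpose_sub, Matrix.transpose_smul, Matrix.transpose_one]
  congr 1
  ext x y
  simp only [Matrix.transpose_apply, HMat, l1dist_comm (y : Site d)]
  congr 1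
  by_cases hxy : x = y
  · subst hxy; rfl
  · rw [if_neg hxy, if_neg (Ne.symm hxy)]

lemma isUnit_det_of_lower_bound {X : Type*} [Fintype X] [DecidableEq X] (K : Matrix X X ℝ)
    {c : ℝ} (hc : 0 < c) (hK : ∀ u, c * l2norm u ≤ l2norm (K.mulVec u)) : IsUnit K.det := by
  rw [isUnit_iff_ne_zero]
  intro hdet
  obtain ⟨u, hu, hKu⟩ := Matrix.exists_mulVec_eq_zero_iff.mpr hdet
  have h1 := hK u
  rw [hKu] at h1
  have h0 : l2norm (0 : X → ℝ) = 0 := by simp [l2norm]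
  rw [h0] at h1
  exact hu (eq_zero_of_l2norm_le_zero (by nlinarith [l2norm_nonneg u]))

/-- Resolvent identity bound: if `K`, `K'` are invertible, `K - K' = -(c • 1)`, `K'` is symmetric
and `‖Pu‖ ≤ s‖Ku‖`, `‖Pu‖ ≤ s‖K'u‖`, then `‖P(K⁻¹ - K'⁻¹)Pᵀ‖ ≤ s²|c|`. -/
lemma l2norm_compressed_resolvent_sub_le {X Y : Type*} [Fintype X] [DecidableEq X] [Fintype Y]
    {K K' : Matrix X X ℝ} {G : Matrix X Y ℝ} {c s : ℝ} (hs : 0 ≤ s)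
    (hK : IsUnit K.det) (hK' : IsUnit K'.det) (hsymm : K'.transpose = K')
    (hsub : K' - K = c • (1 : Matrix X X ℝ))
    (hP : ∀ u, l2norm (G.transpose.mulVec u) ≤ s * l2norm (K.mulVec u))
    (hP' : ∀ u, l2norm (G.transpose.mulVec u) ≤ s * l2norm (K'.mulVec u)) (v : Y → ℝ) :
    l2norm ((G.transpose * (K⁻¹ - K'⁻¹) * G).mulVec v) ≤ s ^ 2 * |c| * l2norm v := by
  have hres : K⁻¹ - K'⁻¹ = c • (K⁻¹ * K'⁻¹) := by
    calc K⁻¹ - K'⁻¹ = K⁻¹ * (K' - K) * K'⁻¹ := by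
          rw [mul_sub, sub_mul, Matrix.nonsing_inv_mul K hK, mul_assoc,
            Matrix.mul_nonsing_inv K' hK', mul_one, one_mul]
      _ = c • (K⁻¹ * K'⁻¹) := by rw [hsub, mul_smul_comm, mul_one, smul_mul_assoc]
  have hinv : ∀ w, l2norm (G.transpose.mulVec (K⁻¹.mulVec w)) ≤ s * l2norm w := by
    intro w
    have := hP (K⁻¹.mulVec w)
    rwa [Matrix.mulVec_mulVec w K, Matrix.mul_nonsing_inv K hK, Matrix.one_mulVec] at this
  have hinv' : ∀ w, l2norm (G.transpose.mulVec (K'⁻¹.mulVec w)) ≤ s * l2norm w := by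
    intro w
    have := hP' (K'⁻¹.mulVec w)
    rwa [Matrix.mulVec_mulVec w K', Matrix.mul_nonsing_inv K' hK', Matrix.one_mulVec] at this
  set w := K'⁻¹.mulVec (G.mulVec v) with hw
  have hwv : l2norm w ≤ s * l2norm v := by
    have hdual : w ⬝ᵥ w = (G.transpose.mulVec (K'⁻¹.mulVec w)) ⬝ᵥ v := by
      conv_lhs => rw [hw, ← hw, Matrix.dotProduct_mulVec, Matrix.dotProduct_mulVec]
      rw [← Matrix.mulVec_transpose, ← Matrix.mulVec_transpose, Matrix.transpose_nonsing_inv,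
        hsymm]
    have hle := dotProduct_le_l2norm_mul (G.transpose.mulVec (K'⁻¹.mulVec w)) v
    rw [← hdual, dotProduct_self_eq_l2norm_sq] at hle
    have h1 := hle.trans (mul_le_mul_of_nonneg_right (hinv' w) (l2norm_nonneg v))
    rcases (l2norm_nonneg w).eq_or_lt with h0 | h0
    · rw [← h0]; exact mul_nonneg hs (l2norm_nonneg v)
    · refine le_of_mul_le_mul_right ?_ h0
      linarith
  have hval : (G.transpose * (K⁻¹ - K'⁻¹) * G).mulVec v =
      c • G.transpose.mulVec (K⁻¹.mulVec w) := by
    rw [hres, hw]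
    simp only [Matrix.mul_smul, Matrix.smul_mul, Matrix.smul_mulVec, Matrix.mulVec_mulVec,
      Matrix.mul_assoc]
  rw [hval, l2norm_smul]
  calc |c| * l2norm (G.transpose.mulVec (K⁻¹.mulVec w)) ≤ |c| * (s * (s * l2norm v)) := by
        gcongr
        exact (hinv w).trans (by gcongr)
    _ = _ := by ring

/-- The Lipschitz constant of the Schur complement when the diagonal of `H_{B̄∖B} - ℰ` is at
least `δ > 2d`. -/
lemma schurC_sub_le {Vhi : Site d → ℝ} {β h ℰ ℰ' δ : ℝ} {ω : Site d → Bool}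
    {B Bbar : Finset (Site d)} (hβ : 0 ≤ β) (hres : ∀ x ∈ Bbar \ B, Vhi x = h)
    (hδ : 2 * (d : ℝ) < δ) (hℰ : ℰ ≤ 2 * d + h - δ) (hℰ' : ℰ' ≤ 2 * d + h - δ) (v : B → ℝ) :
    l2norm ((schurC Vhi β ω B Bbar ℰ - schurC Vhi β ω B Bbar ℰ').mulVec v) ≤
      (2 * d) ^ 2 / (δ ^ 2 - (2 * d) ^ 2) * |ℰ - ℰ'| * l2norm v := by
  have hd : (0 : ℝ) ≤ 2 * d := by positivity
  have hden : 0 < δ ^ 2 - (2 * (d : ℝ)) ^ 2 := by nlinarith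
  have hC : 0 ≤ (2 * (d : ℝ)) ^ 2 / (δ ^ 2 - (2 * d) ^ 2) := by positivity
  have hb := fun (e : ℝ) (he : e ≤ 2 * d + h - δ) =>
    hamiltonian_sub_bounds (ω := ω) (Finset.sdiff_disjoint : Disjoint (Bbar \ B) B) hβ hres hδ he
  have hP : ∀ e, e ≤ 2 * d + h - δ → ∀ u,
      l2norm ((coupling B (Bbar \ B)).transpose.mulVec u) ≤
        Real.sqrt ((2 * (d : ℝ)) ^ 2 / (δ ^ 2 - (2 * d) ^ 2)) *
          l2norm ((HMat Vhi β ω (Bbar \ B) - e • 1).mulVec u) := by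
    intro e he u
    refine (abs_le_of_sq_le_sq' ?_ (mul_nonneg (Real.sqrt_nonneg _) (l2norm_nonneg _))).2
    rw [mul_pow, Real.sq_sqrt hC]
    exact (hb e he u).2
  have hunit := fun e he =>
    isUnit_det_of_lower_bound _ (sub_pos.mpr hδ) fun u => (hb e he u).1
  have key := l2norm_compressed_resolvent_sub_le (Real.sqrt_nonneg _) (hunit ℰ' hℰ') (hunit ℰ hℰ)
    (HMat_sub_smul_one_transpose Vhi β ℰ ω (Bbar \ B)) (c := ℰ' - ℰ)
    (by rw [sub_smul]; abel) (hP ℰ' hℰ') (hP ℰ hℰ) v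
  rw [Real.sq_sqrt hC, abs_sub_comm] at key
  convert key using 3
  simp only [schurC, Matrix.mul_sub, Matrix.sub_mul]
  abel

/-- **Energy-Lipschitz bound for Schur complements over non-resonant annuli**
(Claim 4.5).

If the annulus `B̄ ∖ B` is non-resonant, then for energies
`ℰ, ℰ' ∈ [-ι, 4d+β+ι]` the Schur complements satisfy
`‖S_ℰ - S_{ℰ'}‖ ≤ (2d/(h-4d-β-ι))² |ℰ - ℰ'|` in the `ℓ² → ℓ²` operator norm;
in particular, if `(2d/(h-2d-2))² ≤ (4d+h+1)^{-1.9}`, then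
`‖S_ℰ - S_{ℰ'}‖ ≤ γ^{1.9} |ℰ - ℰ'|` with `γ = 1/(4d+h+β)`. -/
theorem schur_energy_lipschitz
    (d : ℕ) (hd : 1 ≤ d)
    (h β : ℝ) (hh : 4 * (d : ℝ) + 1 < h) (hβ0 : 0 < β) (hβ1 : β ≤ 1)
    (Vhi : Site d → ℝ) (ω : Site d → Bool)
    (B Bbar : Finset (Site d)) (hBB : B ⊆ Bbar)
    (hres : ∀ x ∈ Bbar \ B, Vhi x = h)
    (ℰ ℰ' : ℝ)
    (hℰ : ℰ ∈ Set.Icc (-(iota d h β)) (4 * (d : ℝ) + β + iota d h β))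
    (hℰ' : ℰ' ∈ Set.Icc (-(iota d h β)) (4 * (d : ℝ) + β + iota d h β)) :
    (∀ v : B → ℝ,
      l2norm ((schurC Vhi β ω B Bbar ℰ - schurC Vhi β ω B Bbar ℰ').mulVec v) ≤
        (2 * (d : ℝ) / (h - 4 * d - β - iota d h β)) ^ 2 * |ℰ - ℰ'| * l2norm v) ∧
    ((2 * (d : ℝ) / (h - 2 * d - 2)) ^ 2 ≤ (4 * (d : ℝ) + h + 1) ^ (-(1.9 : ℝ)) →
      ∀ v : B → ℝ,
        l2norm ((schurC Vhi β ω B Bbar ℰ - schurC Vhi β ω B Bbar ℰ').mulVec v) ≤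
          (1 / (4 * (d : ℝ) + h + β)) ^ ((1.9 : ℝ)) * |ℰ - ℰ'| * l2norm v) := by
  have hd1 : (1 : ℝ) ≤ d := by exact_mod_cast hd
  have hι1 : iota d h β ≤ 1 / 100 := min_le_left _ _
  have hι2 : iota d h β ≤ (h - 4 * d - β) / 2 := min_le_right _ _
  have hg : 0 < h - 4 * d - β - iota d h β := by linarith
  set g := h - 4 * d - β - iota d h β with hgdef
  have hmain := schurC_sub_le (ω := ω) hβ0.le hres
    (δ := g + 2 * d) (by linarith) (ℰ := ℰ) (ℰ' := ℰ')
    (by have := hℰ.2; linarith) (by have := hℰ'.2; linarith)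
  refine ⟨fun v => (hmain v).trans ?_, fun hyp v => (hmain v).trans ?_⟩
  · have := l2norm_nonneg v
    gcongr
    rw [div_pow]
    gcongr
    nlinarith
  · have := l2norm_nonneg v
    gcongr
    have hX : 0 < h - 2 * d - 2 := by linarith
    have hXd : (2 * (d : ℝ)) ^ 2 ≤ h - 2 * d - 2 := by
      have h1 : (4 * (d : ℝ) + h + 1) ^ (-(1.9 : ℝ)) ≤ (4 * (d : ℝ) + h + 1) ^ (-(1 : ℝ)) :=
        Real.rpow_le_rpow_of_exponent_le (by linarith) (by norm_num)
      rw [Real.rpow_neg_one] at h1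
      have h2 : (4 * (d : ℝ) + h + 1)⁻¹ ≤ (h - 2 * d - 2)⁻¹ := by
        gcongr
        linarith
      have h3 := (hyp.trans h1).trans h2
      rw [div_pow, div_le_iff₀ (by positivity), sq (h - 2 * (d : ℝ) - 2),
        inv_mul_cancel_left₀ hX.ne'] at h3
      exact h3
    calc (2 * (d : ℝ)) ^ 2 / ((g + 2 * d) ^ 2 - (2 * d) ^ 2)
        ≤ (2 * (d : ℝ)) ^ 2 / (h - 2 * d - 2) ^ 2 := by
          gcongr
          have h1 : h - 2 * d - 2 + 99 / 100 ≤ g + 2 * d := by linarith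
          nlinarith
      _ = (2 * (d : ℝ) / (h - 2 * d - 2)) ^ 2 := (div_pow _ _ _).symm
      _ ≤ (4 * (d : ℝ) + h + 1) ^ (-(1.9 : ℝ)) := hyp
      _ ≤ (4 * (d : ℝ) + h + β) ^ (-(1.9 : ℝ)) :=
          Real.rpow_le_rpow_of_nonpos (by linarith) (by linarith) (by norm_num)
      _ = (1 / (4 * (d : ℝ) + h + β)) ^ (1.9 : ℝ) := by
          rw [one_div, Real.inv_rpow (by linarith), Real.rpow_neg (by linarith)]

end HierABM
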